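/- Let X be a complex Banach space and M : X → X a bounded linear operator that is bijective with bounded inverse M^{−1}. For each n ∈ ℕ let X_n and Y_n be finite-dimensional subspaces of X with dim X_n = dim Y_n, let M_n : X_n → X be a linear map with range contained in Y_n, and let ε_n ≥ 0 satisfy ‖M x − M_n x‖ ≤ ε_n·‖x‖ for all x ∈ X_n. Suppose ε_n → 0 as n → ∞, and suppose there exist n_0 ∈ ℕ and q < 1 with ‖M^{−1}‖·ε_n ≤ q for all n ≥ n_0. Let y ∈ X, x* = M^{−1} y, and let y_n ∈ Y_n with ‖y − y_n‖ → 0. Then for all n ≥ n_0 the equation M_n x_n = y_n has a unique solution x_n* ∈ X_n, and ‖x* − x_n*‖ → 0 as n → ∞. -/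

import Mathlib

open Filter Topology

/-- A-priori error bound for an approximation `N` of `M` on a subspace, where `M` has the bounded
left inverse `Minv`. -/
lemma norm_sub_mul_le_of_consistent {X : Type*} [NormedAddCommGroup X] [NormedSpace ℂ X]
    {M Minv : X →L[ℂ] X} (hleft : ∀ x, Minv (M x) = x) {V : Submodule ℂ X} {N : V →ₗ[ℂ] X}
    {ε q : ℝ} (hε : 0 ≤ ε) (hN : ∀ x : V, ‖M (x : X) - N x‖ ≤ ε * ‖(x : X)‖)
    (hq : ‖Minv‖ * ε ≤ q) (u : X) (x : V) :
    ‖u - x‖ * (1 - q) ≤ ‖Minv‖ * (‖M u - N x‖ + ε * ‖u‖) := by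
  have hinv : ‖u - x‖ ≤ ‖Minv‖ * ‖M u - M x‖ := by
    simpa [hleft] using Minv.le_opNorm (M u - M x)
  have htri : ‖M u - M x‖ ≤ ‖M u - N x‖ + ε * (‖u‖ + ‖u - x‖) := by
    calc ‖M u - M x‖ ≤ ‖M u - N x‖ + ‖N x - M x‖ := norm_sub_le_norm_sub_add_norm_sub _ _ _
      _ ≤ ‖M u - N x‖ + ε * ‖(x : X)‖ := by
        rw [norm_sub_rev (N x)]
        gcongr
        exact hN x
      _ ≤ _ := by
        gcongr
        simpa [norm_sub_rev] using norm_le_norm_add_norm_sub u (x : X)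
  have hmul := mul_le_mul_of_nonneg_left htri (norm_nonneg Minv)
  have habs := mul_le_mul_of_nonneg_right hq (norm_nonneg (u - x))
  linarith

/-- A consistent approximation with small relative error is injective. -/
lemma injective_of_consistent {X : Type*} [NormedAddCommGroup X] [NormedSpace ℂ X]
    {M Minv : X →L[ℂ] X} (hleft : ∀ x, Minv (M x) = x) {V : Submodule ℂ X} {N : V →ₗ[ℂ] X}
    {ε q : ℝ} (hε : 0 ≤ ε) (hN : ∀ x : V, ‖M (x : X) - N x‖ ≤ ε * ‖(x : X)‖)
    (hq : ‖Minv‖ * ε ≤ q) (hq1 : q < 1) : Function.Injective N := by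
  rw [injective_iff_map_eq_zero]
  intro x hx
  have h := norm_sub_mul_le_of_consistent hleft hε hN hq 0 x
  simp only [zero_sub, norm_neg, map_zero, hx, norm_zero, mul_zero, add_zero] at h
  have hzero : ‖(x : X)‖ ≤ 0 := nonpos_of_mul_nonpos_left h (sub_pos.2 hq1)
  simpa using hzero

/-- Assertion (2), the convergence statement, of the general projection-method theorem
of Section 3: if `ε_n → 0`, `‖M⁻¹‖ ε_n ≤ q < 1` for `n ≥ n₀`, and `‖y - y_n‖ → 0`,
then for `n ≥ n₀` the finite-dimensional equations have unique solutions `x_n*` and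
`x_n* → x* = M⁻¹ y` in norm. -/
theorem stmt_14 {X : Type*} [NormedAddCommGroup X] [NormedSpace ℂ X] [CompleteSpace X]
    (M Minv : X →L[ℂ] X)
    (hleft : ∀ x, Minv (M x) = x) (hright : ∀ x, M (Minv x) = x)
    (Xn Yn : ℕ → Submodule ℂ X)
    (hfinX : ∀ n, FiniteDimensional ℂ (Xn n)) (hfinY : ∀ n, FiniteDimensional ℂ (Yn n))
    (hdim : ∀ n, Module.finrank ℂ (Xn n) = Module.finrank ℂ (Yn n))
    (Mn : ∀ n, Xn n →ₗ[ℂ] X) (hrange : ∀ n, ∀ x : Xn n, Mn n x ∈ Yn n)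
    (ε : ℕ → ℝ) (hε : ∀ n, 0 ≤ ε n)
    (hconsist : ∀ n, ∀ x : Xn n, ‖M (x : X) - Mn n x‖ ≤ ε n * ‖(x : X)‖)
    (hε0 : Tendsto ε atTop (nhds 0))
    (n0 : ℕ) (q : ℝ) (hq : q < 1) (hηq : ∀ n ≥ n0, ‖Minv‖ * ε n ≤ q)
    (y : X) (xstar : X) (hxstar : xstar = Minv y)
    (yn : ℕ → X) (hyn : ∀ n, yn n ∈ Yn n)
    (hyconv : Tendsto (fun n => ‖y - yn n‖) atTop (nhds 0)) :
    (∀ n ≥ n0, ∃! x : Xn n, Mn n x = yn n) ∧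
    ∀ xs : (n : ℕ) → Xn n, (∀ n ≥ n0, Mn n (xs n) = yn n) →
      Tendsto (fun n => ‖xstar - (xs n : X)‖) atTop (nhds 0) := by
  refine ⟨fun n hn => ?_, fun xs hxs => ?_⟩
  · have := hfinX n
    have := hfinY n
    have hinj := injective_of_consistent hleft (hε n) (hconsist n) (hηq n hn) hq
    let N : Xn n →ₗ[ℂ] Yn n := (Mn n).codRestrict (Yn n) (hrange n)
    have hNinj : Function.Injective N := fun a b hab => hinj (congrArg Subtype.val hab)
    obtain ⟨x, hx⟩ :=
      (LinearMap.injective_iff_surjective_of_finrank_eq_finrank (hdim n)).1 hNinj ⟨yn n, hyn n⟩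
    have hsol : Mn n x = yn n := congrArg Subtype.val hx
    exact ⟨x, hsol, fun z hz => hinj (hz.trans hsol.symm)⟩
  · have hbound : Tendsto
        (fun n => ‖Minv‖ * (‖y - yn n‖ + ε n * ‖xstar‖) / (1 - q)) atTop (nhds 0) := by
      simpa using ((hyconv.add (hε0.mul_const ‖xstar‖)).const_mul ‖Minv‖).div_const (1 - q)
    refine squeeze_zero' (Eventually.of_forall fun n => norm_nonneg _) ?_ hbound
    filter_upwards [eventually_ge_atTop n0] with n hn
    rw [le_div_iff₀ (sub_pos.2 hq)]
    have h := norm_sub_mul_le_of_consistent hleft (hε n) (hconsist n) (hηq n hn) xstar (xs n)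
    rwa [hxs n hn, show M xstar = y by rw [hxstar, hright]] at h
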